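/- (Cluster expansion inversion for cumulants) Let R be a commutative ring, α a type with decidable equality, and G : Finset α → R. For a finite set T define the cumulant 𝔄(T) := Σ_{P} (−1)^{|P|−1} · (|P|−1)! · Π_{X ∈ P.parts} G(X), where the sum runs over all finite partitions P of T (all P : Finpartition T) and |P| denotes the number of parts of P. Then for every nonempty finite set T one has Σ_{P : Finpartition T} Π_{X ∈ P.parts} 𝔄(X) = G(T); that is, the sum over all partitions of T of the products of cumulants of the parts reconstructs G(T). -/

import Mathlib

/-- The cumulant of a set function `G`, defined by the partition expansion
`𝔄(T) = Σ_P (-1)^{|P|-1} (|P|-1)! Π_{X ∈ P.parts} G(X)` over all finite partitions `P`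
of `T`. -/
noncomputable def cumulant {α : Type*} [DecidableEq α] {R : Type*} [CommRing R]
    (G : Finset α → R) (T : Finset α) : R :=
  ∑ P : Finpartition T,
    (-1 : R) ^ (P.parts.card - 1) * (P.parts.card - 1).factorial *
      ∏ X ∈ P.parts, G X

namespace Finpartition

variable {α : Type*} [DecidableEq α] {T : Finset α}

lemma parts_avoid_of_mem (Q : Finpartition T) {B : Finset α} (hB : B ∈ Q.parts) :
    (Q.avoid B).parts = Q.parts.erase B := by
  have sdiff_of_ne : ∀ d ∈ Q.parts, d ≠ B → d \ B = d := fun d hd hne =>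
    Finset.sdiff_eq_self_of_disjoint (Q.disjoint hd hB hne)
  ext c
  rw [mem_avoid, Finset.mem_erase]
  constructor
  · rintro ⟨d, hd, hdB, rfl⟩
    have hne : d ≠ B := by
      rintro rfl
      exact hdB le_rfl
    rw [sdiff_of_ne d hd hne]
    exact ⟨hne, hd⟩
  · rintro ⟨hne, hc⟩
    refine ⟨c, hc, fun hle => ?_, sdiff_of_ne c hc hne⟩
    exact Q.ne_bot hc ((Q.disjoint hc hB hne).eq_bot_of_le hle)

/-- Partitions of `T` with a distinguished block `B` correspond to nonempty subsets `B` of `T`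
together with a partition of `T \ B`. -/
lemma sum_sum_parts_erase {M : Type*} [AddCommMonoid M]
    (F : Finset α → Finset (Finset α) → M) :
    ∑ Q : Finpartition T, ∑ B ∈ Q.parts, F B (Q.parts.erase B) =
      ∑ B ∈ T.powerset.erase ∅, ∑ P : Finpartition (T \ B), F B P.parts := by
  have hmem : ∀ {B : Finset α}, B ∈ T.powerset.erase ∅ → B ≠ ⊥ ∧ T \ B ⊔ B = T := by
    intro B hB
    rw [Finset.mem_erase, Finset.mem_powerset] at hB
    exact ⟨hB.1, Finset.sdiff_union_of_subset hB.2⟩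
  have hnot : ∀ {B : Finset α}, B ≠ ⊥ → ∀ P : Finpartition (T \ B), B ∉ P.parts :=
    fun hB P h => hB (disjoint_self.1 (Finset.sdiff_disjoint.mono_left (P.subset h)))
  rw [Finset.sum_sigma', Finset.sum_sigma']
  refine Finset.sum_bij'
    (fun x _ => (⟨x.2, x.1.avoid x.2⟩ : Σ B : Finset α, Finpartition (T \ B)))
    (fun y hy => (⟨y.2.extend (hmem (Finset.mem_sigma.1 hy).1).1 Finset.sdiff_disjoint
      (hmem (Finset.mem_sigma.1 hy).1).2, y.1⟩ : Σ _ : Finpartition T, Finset α))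
    ?_ ?_ ?_ ?_ ?_
  · rintro ⟨Q, B⟩ h
    have hB : B ∈ Q.parts := (Finset.mem_sigma.1 h).2
    simp only [Finset.mem_sigma, Finset.mem_univ, and_true, Finset.mem_erase,
      Finset.mem_powerset]
    exact ⟨Q.ne_empty hB, Q.subset hB⟩
  · rintro ⟨B, P⟩ h
    simp
  · rintro ⟨Q, B⟩ h
    have hB : B ∈ Q.parts := (Finset.mem_sigma.1 h).2
    refine Sigma.ext (Finpartition.ext ?_) HEq.rfl
    simp [parts_avoid_of_mem Q hB, Finset.insert_erase hB]
  · rintro ⟨B, P⟩ h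
    refine Sigma.ext rfl (heq_of_eq (Finpartition.ext ?_))
    have hB := hmem (Finset.mem_sigma.1 h).1
    rw [parts_avoid_of_mem _ (by simp)]
    simp [Finset.erase_insert (hnot hB.1 P)]
  · rintro ⟨Q, B⟩ h
    have hB : B ∈ Q.parts := (Finset.mem_sigma.1 h).2
    simp [parts_avoid_of_mem Q hB]

lemma filter_mem_parts (Q : Finpartition T) {a : α} (ha : a ∈ T) :
    {B ∈ Q.parts | a ∈ B} = {Q.part a} := by
  ext B
  simp only [Finset.mem_filter, Finset.mem_singleton]
  constructor
  · rintro ⟨hB, haB⟩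
    exact (Q.part_eq_of_mem hB haB).symm
  · rintro rfl
    exact ⟨Q.part_mem.2 ha, Q.mem_part_self.2 ha⟩

/-- Recursion for a partition sum along the block containing a fixed element. -/
lemma sum_prod_parts {R : Type*} [CommSemiring R] (f : Finset α → R) {a : α} (ha : a ∈ T) :
    ∑ P : Finpartition T, ∏ X ∈ P.parts, f X =
      ∑ B ∈ T.powerset with a ∈ B, f B * ∑ P : Finpartition (T \ B), ∏ X ∈ P.parts, f X := by
  have h := sum_sum_parts_erase (T := T)
    fun B s => if a ∈ B then f B * ∏ X ∈ s, f X else 0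
  have hl : ∀ Q : Finpartition T, (∑ B ∈ Q.parts,
      if a ∈ B then f B * ∏ X ∈ Q.parts.erase B, f X else 0) = ∏ X ∈ Q.parts, f X := by
    intro Q
    rw [← Finset.sum_filter, Q.filter_mem_parts ha, Finset.sum_singleton,
      Finset.mul_prod_erase _ _ (Q.part_mem.2 ha)]
  simp only [hl] at h
  rw [h, Finset.sum_filter, Finset.sum_erase _ (by simp)]
  refine Finset.sum_congr rfl fun B _ => ?_
  split_ifs <;> simp [Finset.mul_sum]

end Finpartition

/-- Recursion recovering `G` from its cumulants, by splitting off the set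
containing a fixed element. -/
lemma sum_cumulant_mul_sdiff {α : Type*} [DecidableEq α] {R : Type*} [CommRing R]
    (G : Finset α → R) {T : Finset α} {a : α} (ha : a ∈ T) :
    cumulant G T + ∑ S ∈ T.powerset.erase T with a ∈ S, cumulant G S * G (T \ S) = G T := by
  have hT : T ≠ ⊥ := Finset.ne_empty_of_mem ha
  have h := Finpartition.sum_sum_parts_erase (T := T) fun B s => if a ∈ B then (0 : R) else
    (-1) ^ (s.card - 1) * (s.card - 1).factorial * (∏ X ∈ s, G X) * G B
  have hl : ∀ Q : Finpartition T, (∑ B ∈ Q.parts, if a ∈ B then (0 : R) else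
      (-1) ^ ((Q.parts.erase B).card - 1) * ((Q.parts.erase B).card - 1).factorial *
        (∏ X ∈ Q.parts.erase B, G X) * G B) =
      (Q.parts.card - 1 : ℕ) * ((-1) ^ (Q.parts.card - 1 - 1) *
        (Q.parts.card - 1 - 1).factorial * ∏ X ∈ Q.parts, G X) := by
    intro Q
    have hcard : {B ∈ Q.parts | ¬ a ∈ B}.card = Q.parts.card - 1 := by
      have := Finset.card_filter_add_card_filter_not (s := Q.parts) (fun B => a ∈ B)
      rw [Q.filter_mem_parts ha, Finset.card_singleton] at this
      omega
    rw [← hcard, ← nsmul_eq_mul, ← Finset.sum_const, hcard, Finset.sum_filter]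
    refine Finset.sum_congr rfl fun B hB => ?_
    rw [Finset.card_erase_of_mem hB, mul_assoc _ _ (G B), Finset.prod_erase_mul _ _ hB]
    split_ifs <;> simp_all
  have hr : (∑ B ∈ T.powerset.erase ∅, ∑ P : Finpartition (T \ B), if a ∈ B then (0 : R) else
      (-1) ^ (P.parts.card - 1) * (P.parts.card - 1).factorial * (∏ X ∈ P.parts, G X) * G B) =
      ∑ S ∈ T.powerset.erase T with a ∈ S, cumulant G S * G (T \ S) := by
    rw [Finset.sum_filter]
    refine Finset.sum_nbij' (T \ ·) (T \ ·) ?_ ?_ ?_ ?_ ?_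
    · intro B hB
      simp only [Finset.mem_erase, Finset.mem_powerset] at hB ⊢
      refine ⟨fun h => hB.1 ?_, Finset.sdiff_subset⟩
      rw [← Finset.sdiff_sdiff_eq_self hB.2, h, Finset.sdiff_self]
    · intro B hB
      simp only [Finset.mem_erase, Finset.mem_powerset] at hB ⊢
      exact ⟨fun h => hB.1 (hB.2.antisymm (Finset.sdiff_eq_empty_iff_subset.1 h)),
        Finset.sdiff_subset⟩
    · intro B hB
      exact Finset.sdiff_sdiff_eq_self (Finset.mem_powerset.1 (Finset.mem_of_mem_erase hB))
    · intro B hB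
      exact Finset.sdiff_sdiff_eq_self (Finset.mem_powerset.1 (Finset.mem_of_mem_erase hB))
    · intro B hB
      rw [Finset.sdiff_sdiff_eq_self (Finset.mem_powerset.1 (Finset.mem_of_mem_erase hB))]
      by_cases haB : a ∈ B <;> simp [haB, ha, cumulant, Finset.sum_mul]
  rw [hr] at h
  simp only [hl] at h
  rw [← h, cumulant, ← Finset.sum_add_distrib,
    Finset.sum_eq_single (Finpartition.indiscrete hT)]
  · simp
  · intro Q _ hQ
    have hpos : 0 < Q.parts.card := Finset.card_pos.2 (Q.parts_nonempty hT)
    have hne : Q.parts.card ≠ 1 := by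
      intro h1
      obtain ⟨B, hB⟩ := Finset.card_eq_one.1 h1
      refine hQ (Finpartition.ext ?_)
      have := Q.biUnion_parts
      rw [hB, Finset.singleton_biUnion, id] at this
      rw [hB, this, Finpartition.indiscrete_parts]
    obtain ⟨k, hk⟩ : ∃ k, Q.parts.card = k + 2 := ⟨Q.parts.card - 2, by omega⟩
    rw [hk, show k + 2 - 1 = k + 1 from rfl, Nat.add_sub_cancel, Nat.factorial_succ]
    push_cast
    ring
  · simp

/-- cluster expansion inversion for cumulants: for every nonempty finite
set `T`, summing over all partitions of `T` the products of cumulants of the parts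
reconstructs `G(T)`. -/
theorem cumulant_cluster_expansion_inversion {α : Type*} [DecidableEq α]
    {R : Type*} [CommRing R] (G : Finset α → R) (T : Finset α) (hT : T.Nonempty) :
    ∑ P : Finpartition T, ∏ X ∈ P.parts, cumulant G X = G T := by
  induction T using Finset.strongInduction with
  | H T ih =>
    obtain ⟨a, ha⟩ := hT
    have hempty : ∀ S : Finset α, S = ∅ →
        ∑ P : Finpartition S, ∏ X ∈ P.parts, cumulant G X = 1 := by
      rintro _ rfl
      have hparts : ∀ P : Finpartition (∅ : Finset α), P.parts = ∅ :=
        fun P => P.parts_eq_empty_iff.2 rfl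
      have : Unique (Finpartition (∅ : Finset α)) :=
        inferInstanceAs (Unique (Finpartition (⊥ : Finset α)))
      simp [hparts]
    rw [Finpartition.sum_prod_parts _ ha, ← sum_cumulant_mul_sdiff G ha, Finset.filter_erase,
      ← Finset.add_sum_erase _ _ (by simp [ha] : T ∈ {B ∈ T.powerset | a ∈ B}),
      hempty _ (Finset.sdiff_self T), mul_one]
    congr 1
    refine Finset.sum_congr rfl fun S hS => ?_
    simp only [Finset.mem_erase, Finset.mem_filter, Finset.mem_powerset] at hS
    obtain ⟨hne, hST, haS⟩ := hS
    rw [ih _ (Finset.sdiff_ssubset hST ⟨a, haS⟩)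
      (Finset.sdiff_nonempty.2 fun h => hne (hST.antisymm h))]
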